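/- arXiv:2509.25810 — 2 statements merged into one kernel-verified Lean document; each statement's English description precedes it below -/
import Mathlib

section
/- Suppose the natural number N satisfies N ≥ (k·log n + log(1/δ))/σ. Then the μ^⊗N-probability of the event { ω : there exists a subset S ⊆ Z with |S| = k such that S is (ε,σ)-suboptimal and g(ω_i, S) ≤ ε for every i < N } is at most δ. (Pruning efficiency: with Θ(k·log(n/δ)/σ) i.i.d. expert-task samples, all (ε,σ)-suboptimal size-k action subsets are pruned away with probability at least 1 − δ.) -/
open MeasureTheory

/-- If the superlevel set `{f > ε}` has mass at least `σ`, then `N` independent samples all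
avoid it with probability at most `exp (-(σ * N))`. -/
theorem pi_forall_le_le_exp {M : Type*} [MeasurableSpace M] (μ : Measure M)
    [IsProbabilityMeasure μ] {f : M → ℝ} (hf : Measurable f) {ε σ : ℝ} (hσ : 0 ≤ σ)
    (h : ENNReal.ofReal σ ≤ μ {m | ε < f m}) (N : ℕ) :
    (Measure.pi fun _ : Fin N => μ) {ω | ∀ i, f (ω i) ≤ ε} ≤
      ENNReal.ofReal (Real.exp (-(σ * N))) := by
  have hpi : {ω : Fin N → M | ∀ i, f (ω i) ≤ ε} =
      Set.pi Set.univ fun _ => {m | f m ≤ ε} := by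
    ext ω
    simp
  have hcompl : {m | f m ≤ ε} = {m | ε < f m}ᶜ := by
    ext m
    simp
  have hle : μ {m | f m ≤ ε} ≤ ENNReal.ofReal (Real.exp (-σ)) := by
    rw [hcompl, prob_compl_eq_one_sub (measurableSet_lt measurable_const hf)]
    calc 1 - μ {m | ε < f m} ≤ 1 - ENNReal.ofReal σ := tsub_le_tsub_left h 1
      _ = ENNReal.ofReal (1 - σ) := by rw [ENNReal.ofReal_sub _ hσ, ENNReal.ofReal_one]
      _ ≤ ENNReal.ofReal (Real.exp (-σ)) :=
        ENNReal.ofReal_le_ofReal (Real.one_sub_le_exp_neg σ)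
  rw [hpi, Measure.pi_pi, Finset.prod_const, Finset.card_univ, Fintype.card_fin]
  calc μ {m | f m ≤ ε} ^ N ≤ ENNReal.ofReal (Real.exp (-σ)) ^ N := by gcongr
    _ = ENNReal.ofReal (Real.exp (-(σ * N))) := by
      rw [← ENNReal.ofReal_pow (Real.exp_pos _).le, ← Real.exp_nat_mul]
      congr 2
      ring

/-- Pruning efficiency: with `N ≥ (k·log n + log(1/δ))/σ` i.i.d. expert-task samples,
all `(ε,σ)`-suboptimal size-`k` action subsets are pruned away with probability at
least `1 - δ`. -/
theorem pruning_efficiency {M : Type*} [MeasurableSpace M]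
    (μ : Measure M) [IsProbabilityMeasure μ]
    {Z : Type*} [Fintype Z]
    (n : ℕ) (hn : n = Fintype.card Z) (hn1 : 1 ≤ n)
    (k : ℕ) (hk : k ≤ n)
    (ε σ δ : ℝ) (hσ : σ ∈ Set.Ioc (0 : ℝ) 1) (hδ : δ ∈ Set.Ioc (0 : ℝ) 1)
    (g : M → Finset Z → ℝ) (hg : ∀ S : Finset Z, Measurable fun m => g m S)
    (N : ℕ) (hN : ((k : ℝ) * Real.log n + Real.log (1 / δ)) / σ ≤ (N : ℝ)) :
    (Measure.pi fun _ : Fin N => μ)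
        {ω | ∃ S : Finset Z, S.card = k ∧
          ENNReal.ofReal σ ≤ μ {m | ε < g m S} ∧
          ∀ i : Fin N, g (ω i) S ≤ ε} ≤ ENNReal.ofReal δ := by
  obtain ⟨hσ0, -⟩ := hσ
  obtain ⟨hδ0, -⟩ := hδ
  classical
  set T : Finset (Finset Z) := {S ∈ Finset.powersetCard k Finset.univ |
    ENNReal.ofReal σ ≤ μ {m | ε < g m S}} with hT
  have hcard : T.card ≤ n ^ k := by
    calc T.card ≤ (Finset.powersetCard k (Finset.univ : Finset Z)).card :=
        Finset.card_filter_le _ _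
      _ = n.choose k := by rw [Finset.card_powersetCard, Finset.card_univ, hn]
      _ ≤ n ^ k := Nat.choose_le_pow n k
  have hn0 : (0 : ℝ) < n := by exact_mod_cast hn1
  have hexp : (n : ℝ) ^ k * Real.exp (-(σ * N)) ≤ δ := by
    rw [div_le_iff₀ hσ0, one_div, Real.log_inv] at hN
    calc (n : ℝ) ^ k * Real.exp (-(σ * N))
        = Real.exp (k * Real.log n - σ * N) := by
          rw [sub_eq_add_neg, Real.exp_add, Real.exp_nat_mul, Real.exp_log hn0]
      _ ≤ Real.exp (Real.log δ) := Real.exp_le_exp.2 (by linarith)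
      _ = δ := Real.exp_log hδ0
  calc (Measure.pi fun _ : Fin N => μ)
        {ω | ∃ S : Finset Z, S.card = k ∧
          ENNReal.ofReal σ ≤ μ {m | ε < g m S} ∧
          ∀ i : Fin N, g (ω i) S ≤ ε}
      ≤ (Measure.pi fun _ : Fin N => μ) (⋃ S ∈ T, {ω | ∀ i, g (ω i) S ≤ ε}) := by
        refine measure_mono ?_
        rintro ω ⟨S, hS, hbad, hω⟩
        have hST : S ∈ T := by simp [hT, hS, hbad]
        exact Set.mem_biUnion hST hω
    _ ≤ ∑ S ∈ T, (Measure.pi fun _ : Fin N => μ) {ω | ∀ i, g (ω i) S ≤ ε} :=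
        measure_biUnion_finset_le _ _
    _ ≤ ∑ _S ∈ T, ENNReal.ofReal (Real.exp (-(σ * N))) :=
        Finset.sum_le_sum fun S hS =>
          pi_forall_le_le_exp μ (hg S) hσ0.le (Finset.mem_filter.1 hS).2 N
    _ = ENNReal.ofReal (T.card * Real.exp (-(σ * N))) := by
        rw [Finset.sum_const, nsmul_eq_mul, ENNReal.ofReal_mul (Nat.cast_nonneg _),
          ENNReal.ofReal_natCast]
    _ ≤ ENNReal.ofReal δ := by
        refine ENNReal.ofReal_le_ofReal (le_trans ?_ hexp)
        gcongr
        exact_mod_cast hcard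
end

section
/- For all V₁, V₂ : S → ℝ, max_{s ∈ S} |T V₁(s) − T V₂(s)| ≤ γ̄ · max_{s ∈ S} |V₁(s) − V₂(s)|, i.e., the generalized Bellman operator over temporally-extended actions is a γ̄-contraction in the sup norm; moreover γ̄ ≤ γ. (Value iteration with action abstractions contracts at the faster rate γ̄ = sup E[γ^τ].) -/
theorem abs_ciSup_sub_ciSup_le {ι : Type*} [Finite ι] [Nonempty ι] {f g : ι → ℝ} {c : ℝ}
    (h : ∀ i, |f i - g i| ≤ c) : |(⨆ i, f i) - ⨆ i, g i| ≤ c := by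
  have hf : (⨆ i, f i) ≤ (⨆ i, g i) + c := ciSup_le fun i => by
    linarith [(abs_le.1 (h i)).2, le_ciSup (Set.finite_range g).bddAbove i]
  have hg : (⨆ i, g i) ≤ (⨆ i, f i) + c := ciSup_le fun i => by
    linarith [(abs_le.1 (h i)).1, le_ciSup (Set.finite_range f).bddAbove i]
  exact abs_le.2 ⟨by linarith, by linarith⟩

theorem abs_tsum_mul_sub_tsum_mul_le {α : Type*} {w f g : α → ℝ} {c : ℝ}
    (hw : ∀ a, 0 ≤ w a) (hws : Summable w) (hf : Summable fun a => w a * f a)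
    (hg : Summable fun a => w a * g a) (h : ∀ a, |f a - g a| ≤ c) :
    |∑' a, w a * f a - ∑' a, w a * g a| ≤ (∑' a, w a) * c := by
  rw [← hf.tsum_sub hg, ← Real.norm_eq_abs, ← tsum_mul_right]
  refine tsum_of_norm_bounded (hws.mul_right c).hasSum fun a => ?_
  rw [← mul_sub, Real.norm_eq_abs, abs_mul, abs_of_nonneg (hw a)]
  exact mul_le_mul_of_nonneg_left (h a) (hw a)

/-- Value iteration with temporally-extended action abstractions: the generalized Bellman
operator is a `γ̄`-contraction in the sup norm, and `γ̄ ≤ γ`. -/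
theorem bellman_contraction {S Z : Type*} [Fintype S] [Fintype Z] [Nonempty S] [Nonempty Z]
    (γ : ℝ) (hγ : γ ∈ Set.Ioo (0 : ℝ) 1)
    (r : S → Z → ℝ) (P : S → Z → ℕ × S → ℝ)
    (hPnn : ∀ s z p, 0 ≤ P s z p)
    (hPsum : ∀ s z, Summable (P s z))
    (hP1 : ∀ s z, ∑' p : ℕ × S, P s z p = 1)
    (hP0 : ∀ s z s', P s z (0, s') = 0)
    (γbar : ℝ) (hγbar : γbar = ⨆ s : S, ⨆ z : Z, ∑' p : ℕ × S, P s z p * γ ^ p.1)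
    (T : (S → ℝ) → (S → ℝ))
    (hT : ∀ V s, T V s = ⨆ z : Z, (r s z + ∑' p : ℕ × S, P s z p * γ ^ p.1 * V p.2)) :
    γbar ≤ γ ∧
      ∀ V₁ V₂ : S → ℝ,
        (⨆ s : S, |T V₁ s - T V₂ s|) ≤ γbar * ⨆ s : S, |V₁ s - V₂ s| := by
  obtain ⟨hγ0, hγ1⟩ := hγ
  have hw (s z p) : 0 ≤ P s z p * γ ^ p.1 := mul_nonneg (hPnn s z p) (pow_nonneg hγ0.le _)
  have hws (s z) : Summable fun p : ℕ × S => P s z p * γ ^ p.1 :=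
    (hPsum s z).of_nonneg_of_le (hw s z) fun p =>
      mul_le_of_le_one_right (hPnn s z p) (pow_le_one₀ hγ0.le hγ1.le)
  have hwγ (s z) : ∑' p : ℕ × S, P s z p * γ ^ p.1 ≤ γ := by
    calc ∑' p : ℕ × S, P s z p * γ ^ p.1 ≤ ∑' p : ℕ × S, P s z p * γ := by
          refine (hws s z).tsum_le_tsum ?_ ((hPsum s z).mul_right γ)
          rintro ⟨_ | n, s'⟩
          · simp [hP0]
          · exact mul_le_mul_of_nonneg_left
              (pow_le_of_le_one hγ0.le hγ1.le n.succ_ne_zero) (hPnn _ _ _)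
      _ = γ := by rw [tsum_mul_right, hP1, one_mul]
  have hwbar (s z) : ∑' p : ℕ × S, P s z p * γ ^ p.1 ≤ γbar := by
    rw [hγbar]
    exact (le_ciSup (f := fun z => ∑' p : ℕ × S, P s z p * γ ^ p.1)
      (Set.finite_range _).bddAbove z).trans
      (le_ciSup (f := fun s => ⨆ z : Z, ∑' p : ℕ × S, P s z p * γ ^ p.1)
        (Set.finite_range _).bddAbove s)
  refine ⟨hγbar ▸ ciSup_le fun s => ciSup_le fun z => hwγ s z, fun V₁ V₂ => ?_⟩
  have hV (V : S → ℝ) (s z) : Summable fun p : ℕ × S => P s z p * γ ^ p.1 * V p.2 := by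
    refine ((hws s z).mul_right (⨆ s, |V s|)).of_norm_bounded fun p => ?_
    rw [Real.norm_eq_abs, abs_mul, abs_of_nonneg (hw s z p)]
    exact mul_le_mul_of_nonneg_left
      (le_ciSup (f := fun s => |V s|) (Set.finite_range _).bddAbove p.2) (hw s z p)
  have hdist (s) : |V₁ s - V₂ s| ≤ ⨆ s : S, |V₁ s - V₂ s| :=
    le_ciSup (f := fun s => |V₁ s - V₂ s|) (Set.finite_range _).bddAbove s
  refine ciSup_le fun s => ?_
  rw [hT, hT]
  refine abs_ciSup_sub_ciSup_le fun z => ?_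
  rw [add_sub_add_left_eq_sub]
  exact (abs_tsum_mul_sub_tsum_mul_le (hw s z) (hws s z) (hV V₁ s z) (hV V₂ s z)
    fun p => hdist p.2).trans
    (mul_le_mul_of_nonneg_right (hwbar s z) (Real.iSup_nonneg fun _ => abs_nonneg _))
end
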